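/- Let n ≥ 2, d ≥ 1, and let f_1,…,f_n : ℝ^d → ℝ be convex functions. Suppose the n-agent network is (k+1)-redundant for some 0 ≤ k ≤ n−2, and that argmin_x Σ_{i∈S} f_i(x) is nonempty for every subset S ⊆ {1,…,n} with |S| = n−k−1. Then the n-agent network is k-redundant. -/

import Mathlib

/-- The set of minimizers of `g` over `ℝ^d`. -/
def argminSet {d : ℕ} (g : EuclideanSpace ℝ (Fin d) → ℝ) : Set (EuclideanSpace ℝ (Fin d)) :=
  {x | ∀ y, g x ≤ g y}

/-- An `n`-agent network with objectives `f` is `k`-redundant if any two subsets of agents of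
cardinality `n - k` have the same set of minimizers of the sum of their objectives. -/
def Redundant (n d k : ℕ) (f : Fin n → EuclideanSpace ℝ (Fin d) → ℝ) : Prop :=
  ∀ S₁ S₂ : Finset (Fin n), S₁.card = n - k → S₂.card = n - k →
    argminSet (fun x => ∑ i ∈ S₁, f i x) = argminSet (fun x => ∑ i ∈ S₂, f i x)

/-- Summing over a finite set with one element left out, for every choice of that element,
counts each term `card - 1` times. -/
theorem sum_sum_erase_eq {ι : Type*} [DecidableEq ι] (T : Finset ι) (a : ι → ℝ) :
    ∑ j ∈ T, ∑ i ∈ T.erase j, a i = ((T.card : ℝ) - 1) * ∑ i ∈ T, a i := by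
  have h : ∀ j ∈ T, ∑ i ∈ T.erase j, a i = ∑ i ∈ T, a i - a j :=
    fun j hj => Finset.sum_erase_eq_sub hj
  rw [Finset.sum_congr rfl h, Finset.sum_sub_distrib, Finset.sum_const, nsmul_eq_mul]
  ring

/-- If all the sums leaving out one element of `T` have the same nonempty set of minimizers, then
this is also the set of minimizers of the sum over `T`. -/
theorem argminSet_sum_eq_of_erase {ι : Type*} [DecidableEq ι] {d : ℕ}
    {f : ι → EuclideanSpace ℝ (Fin d) → ℝ} {T : Finset ι} (hT : 2 ≤ T.card)
    {X : Set (EuclideanSpace ℝ (Fin d))} (hX : X.Nonempty)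
    (h : ∀ j ∈ T, argminSet (fun x => ∑ i ∈ T.erase j, f i x) = X) :
    argminSet (fun x => ∑ i ∈ T, f i x) = X := by
  have hc : (0 : ℝ) < (T.card : ℝ) - 1 := by
    have : (2 : ℝ) ≤ T.card := by exact_mod_cast hT
    linarith
  have hle : ∀ x ∈ X, ∀ j ∈ T, ∀ y, ∑ i ∈ T.erase j, f i x ≤ ∑ i ∈ T.erase j, f i y := by
    intro x hx j hj
    rw [← h j hj] at hx
    exact hx
  ext y
  constructor
  · intro hy
    obtain ⟨x, hx⟩ := hX
    have hsum : ∑ j ∈ T, ∑ i ∈ T.erase j, f i x = ∑ j ∈ T, ∑ i ∈ T.erase j, f i y := by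
      refine le_antisymm (Finset.sum_le_sum fun j hj => hle x hx j hj y) ?_
      rw [sum_sum_erase_eq, sum_sum_erase_eq]
      exact mul_le_mul_of_nonneg_left (hy x) hc.le
    have heq := (Finset.sum_eq_sum_iff_of_le fun j hj => hle x hx j hj y).1 hsum
    obtain ⟨j, hj⟩ : T.Nonempty := Finset.card_pos.1 (by omega)
    rw [← h j hj]
    exact fun z => (heq j hj).symm.le.trans (hle x hx j hj z)
  · intro hy z
    have hsum := Finset.sum_le_sum fun j hj => hle y hy j hj z
    rw [sum_sum_erase_eq, sum_sum_erase_eq] at hsum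
    exact le_of_mul_le_mul_left hsum hc

theorem stmt2 (n d k : ℕ) (hn : 2 ≤ n) (hd : 1 ≤ d) (hk : k ≤ n - 2)
    (f : Fin n → EuclideanSpace ℝ (Fin d) → ℝ)
    (hconv : ∀ i, ConvexOn ℝ Set.univ (f i))
    (hred : Redundant n d (k + 1) f)
    (hne : ∀ S : Finset (Fin n), S.card = n - k - 1 →
      (argminSet (fun x => ∑ i ∈ S, f i x)).Nonempty) :
    Redundant n d k f := by
  intro S₁ S₂ h₁ h₂
  have hcard : ∀ S : Finset (Fin n), S.card = n - k → ∀ j ∈ S, (S.erase j).card = n - k - 1 := by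
    intro S hS j hj
    rw [Finset.card_erase_of_mem hj, hS]
  obtain ⟨j₀, hj₀⟩ : S₁.Nonempty := Finset.card_pos.1 (by omega)
  have key : ∀ S : Finset (Fin n), S.card = n - k →
      argminSet (fun x => ∑ i ∈ S, f i x) = argminSet (fun x => ∑ i ∈ S₁.erase j₀, f i x) :=
    fun S hS => argminSet_sum_eq_of_erase (by omega) (hne _ (hcard S₁ h₁ j₀ hj₀))
      fun j hj => hred _ _ (hcard S hS j hj) (hcard S₁ h₁ j₀ hj₀)
  rw [key S₁ h₁, key S₂ h₂]
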